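/- Let k, λ ∈ ℂ and let Ω ⊂ ℝ² be an open connected set symmetric with respect to L = {x₂ = 0} satisfying the column condition: for every (x₁,x₂) ∈ Ω⁺ one has (x₁,0) ∈ L̃ and {(x₁,s) : 0 < s < x₂} ⊂ Ω⁺. Let u solve the Helmholtz equation Δu + k²u = 0 on Ω⁺, with u, ∂₁u, ∂₂u extending continuously to Ω⁺ ∪ L̃, and ∂₂u + iλu = 0 on L̃. Define ũ := u on Ω⁺ ∪ L̃ and ũ(x₁,x₂) := u(x₁,−x₂) + 2iλ e^{−iλx₂} ∫₀^{−x₂} e^{−iλs} u(x₁,s) ds for (x₁,x₂) ∈ Ω⁻. Then ũ solves the Helmholtz equation Δũ + k²ũ = 0 on Ω. -/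

import Mathlib

noncomputable section

open Set

/-- The first partial derivative of `f : ℝ × ℝ → ℂ`. -/
def pd1 (f : ℝ × ℝ → ℂ) (x : ℝ × ℝ) : ℂ := deriv (fun s : ℝ => f (s, x.2)) x.1

/-- The second partial derivative of `f : ℝ × ℝ → ℂ`. -/
def pd2 (f : ℝ × ℝ → ℂ) (x : ℝ × ℝ) : ℂ := deriv (fun s : ℝ => f (x.1, s)) x.2

/-- `w` is harmonic on `S`: twice continuously differentiable with `Δw = 0` on `S`. -/
def HarmonicOn (w : ℝ × ℝ → ℂ) (S : Set (ℝ × ℝ)) : Prop :=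
  ContDiffOn ℝ 2 w S ∧ ∀ x ∈ S, pd1 (pd1 w) x + pd2 (pd2 w) x = 0

/-- `u` solves the Helmholtz equation `Δu + k²u = 0` on `S` (twice continuously
differentiable solutions). -/
def HelmholtzEq (k : ℂ) (u : ℝ × ℝ → ℂ) (S : Set (ℝ × ℝ)) : Prop :=
  ContDiffOn ℝ 2 u S ∧ ∀ x ∈ S, pd1 (pd1 u) x + pd2 (pd2 u) x + k ^ 2 * u x = 0

/-- `Ω` is symmetric with respect to the line `L = {x₂ = 0}`. -/
def SymmetricWrtL (Ω : Set (ℝ × ℝ)) : Prop :=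
  ∀ x : ℝ × ℝ, x ∈ Ω ↔ ((x.1, -x.2) : ℝ × ℝ) ∈ Ω

/-- `Ω⁺`, the part of `Ω` above the line `L`. -/
def Opos (Ω : Set (ℝ × ℝ)) : Set (ℝ × ℝ) := {x ∈ Ω | 0 < x.2}

/-- `Ω⁻`, the part of `Ω` below the line `L`. -/
def Oneg (Ω : Set (ℝ × ℝ)) : Set (ℝ × ℝ) := {x ∈ Ω | x.2 < 0}

/-- `L̃ = L ∩ Ω`. -/
def Ltil (Ω : Set (ℝ × ℝ)) : Set (ℝ × ℝ) := {x ∈ Ω | x.2 = 0}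

/-- The column condition: for every `x ∈ Ω⁺`, the foot point `(x₁, 0)` belongs to `L̃`
and the whole vertical segment below `x` lies in `Ω⁺`. -/
def ColumnCond (Ω : Set (ℝ × ℝ)) : Prop :=
  ∀ x ∈ Opos Ω, ((x.1, (0:ℝ)) : ℝ × ℝ) ∈ Ltil Ω ∧
    ∀ s : ℝ, 0 < s → s < x.2 → ((x.1, s) : ℝ × ℝ) ∈ Opos Ω

/-- The reflected function: equal to `w` on `{x₂ ≥ 0}` and to
`w(x₁,-x₂) + 2iλ e^{-iλx₂} ∫₀^{-x₂} e^{-iλs} w(x₁,s) ds` below the line `{x₂ = 0}`. -/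
def reflExt (lam : ℂ) (w : ℝ × ℝ → ℂ) (x : ℝ × ℝ) : ℂ :=
  if 0 ≤ x.2 then w x
  else
    w ((x.1, -x.2) : ℝ × ℝ) +
      2 * Complex.I * lam * Complex.exp (-(Complex.I * lam * (x.2 : ℂ))) *
        ∫ s in (0:ℝ)..(-x.2), Complex.exp (-(Complex.I * lam * (s : ℂ))) * w ((x.1, s) : ℝ × ℝ)

section helpers

open Set MeasureTheory Complex

lemma locInt_inv : LocallyIntegrable (fun z : ℂ => z⁻¹) volume := by
  apply locallyIntegrable_of_norm_le_rpow (C := 1) (α := 1)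
  · simp
  · refine Filter.Eventually.of_forall fun z => ?_
    simp [Real.rpow_neg_one]
  · exact measurable_inv.aestronglyMeasurable
  · simp

lemma polar_pompeiu (H : ℂ → ℂ) (hH : ContDiff ℝ 1 H) (hc : HasCompactSupport H) :
    ∫ z, z⁻¹ * (fderiv ℝ H z 1 + I * fderiv ℝ H z I) = - (2 * Real.pi) * H 0 := by
  obtain ⟨R, hR0, hR⟩ : ∃ R : ℝ, 0 < R ∧ ∀ z : ℂ, R ≤ ‖z‖ → z ∉ tsupport H := by
    obtain ⟨R, hR⟩ := hc.isCompact.isBounded.subset_ball 0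
    refine ⟨max R 1, by positivity, fun z hz hz' => ?_⟩
    have := hR hz'
    simp at this
    have := le_max_left R 1
    linarith
  have hdf : Differentiable ℝ H := hH.differentiable (by norm_num)
  have hcf : Continuous (fderiv ℝ H) := hH.continuous_fderiv (by norm_num)
  rw [← Complex.integral_comp_polarCoord_symm, polarCoord_target]
  set e : ℝ → ℂ := fun θ => Complex.exp (θ * I) with he
  have hec : Continuous e := by fun_prop
  set A : ℝ × ℝ → ℂ := fun p => fderiv ℝ H (p.1 * e p.2) (e p.2) with hA
  set B : ℝ × ℝ → ℂ := fun p => fderiv ℝ H (p.1 * e p.2) (I * e p.2) with hB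
  have hAc : Continuous A := by
    apply Continuous.clm_apply
    · exact hcf.comp (by fun_prop)
    · fun_prop
  have hBc : Continuous B := by
    apply Continuous.clm_apply
    · exact hcf.comp (by fun_prop)
    · fun_prop
  have hen : ∀ θ, ‖e θ‖ = 1 := fun θ => by simp [he, Complex.norm_exp]
  have hz0 : ∀ p : ℝ × ℝ, p ∉ Icc 0 R ×ˢ Icc (-Real.pi) Real.pi → p ∈ Ioi (0:ℝ) ×ˢ Ioo (-Real.pi) Real.pi → fderiv ℝ H (p.1 * e p.2) = 0 := by
    rintro ⟨r, θ⟩ h1 ⟨h2, h3⟩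
    simp only [mem_prod, mem_Icc, mem_Ioi, mem_Ioo] at h1 h2 h3
    have : R ≤ r := by
      by_contra hcon
      exact h1 ⟨⟨h2.le, by linarith⟩, h3.1.le, h3.2.le⟩
    have h4 := hR (r * e θ) (by simp [hen, abs_of_pos h2, this])
    have := support_fderiv_subset (𝕜 := ℝ) (f := H)
    by_contra hcon
    exact h4 (this hcon)
  have hint : ∀ F : ℝ × ℝ → ℂ, Continuous F → IntegrableOn F (Ioc (0:ℝ) R ×ˢ Ioo (-Real.pi) Real.pi) := by
    intro F hF
    exact (hF.continuousOn.integrableOn_compact (isCompact_Icc.prod isCompact_Icc)).mono_set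
      (prod_mono Ioc_subset_Icc_self Ioo_subset_Icc_self)
  calc _ = ∫ p in Ioi (0:ℝ) ×ˢ Ioo (-Real.pi) Real.pi, (A p + I * B p) := by
        apply setIntegral_congr_fun (measurableSet_Ioi.prod measurableSet_Ioo)
        rintro ⟨r, θ⟩ ⟨h2, h3⟩
        simp only [mem_Ioi] at h2
        have h5 : (Real.cos θ + Real.sin θ * I : ℂ) = e θ := by
          simp [he, Complex.exp_mul_I]
        have h6 : e θ = Real.cos θ • (1:ℂ) + Real.sin θ • I := by
          rw [← h5]; simp
        have h7 : I * e θ = -Real.sin θ • (1:ℂ) + Real.cos θ • I := by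
          rw [← h5]; simp only [Complex.real_smul, Complex.ofReal_neg]; linear_combination (Real.sin θ : ℂ) * I_mul_I
        have hcs : (Real.cos θ : ℂ) ^ 2 + (Real.sin θ : ℂ) ^ 2 = 1 := by
          exact_mod_cast Real.cos_sq_add_sin_sq θ
        have hr : (r : ℂ) ≠ 0 := by exact_mod_cast h2.ne'
        have h8 : (e θ)⁻¹ = Real.cos θ - Real.sin θ * I := by
          rw [← h5]
          apply inv_eq_of_mul_eq_one_right
          linear_combination hcs - (Real.sin θ : ℂ)^2 * I_mul_I
        simp only [Complex.polarCoord_symm_apply, h5, hA, hB]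
        generalize fderiv ℝ H (r * e θ) = D
        rw [h7, congrArg D h6, map_add, map_add, map_smul, map_smul, map_smul, map_smul]
        simp only [Complex.real_smul, mul_inv, h8, Complex.ofReal_neg]
        rw [mul_assoc, mul_inv_cancel_left₀ hr]
        linear_combination  (-(Real.sin θ : ℂ) * D I) * I_mul_I
    _ = ∫ p in Ioc (0:ℝ) R ×ˢ Ioo (-Real.pi) Real.pi, (A p + I * B p) := by
        apply setIntegral_eq_of_subset_of_forall_sdiff_eq_zero
          (measurableSet_Ioi.prod measurableSet_Ioo)
        · exact prod_mono Ioc_subset_Ioi_self subset_rfl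
        · rintro ⟨r, θ⟩ ⟨h1, h2⟩
          have : fderiv ℝ H (((r, θ) : ℝ × ℝ).1 * e ((r, θ) : ℝ × ℝ).2) = 0 := by
            apply hz0 _ _ h1
            intro h3
            exact h2 ⟨⟨h1.1, h3.1.2⟩, h1.2⟩
          simp only [hA, hB, this]
          simp
    _ = (∫ p in Ioc (0:ℝ) R ×ˢ Ioo (-Real.pi) Real.pi, A p) + I * ∫ p in Ioc (0:ℝ) R ×ˢ Ioo (-Real.pi) Real.pi, B p := by
        rw [integral_add (hint A hAc), integral_const_mul]
        exact (hint B hBc).const_mul I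
    _ = (∫ θ in (-Real.pi)..Real.pi, ∫ r in (0:ℝ)..R, A (r, θ)) + I * ∫ r in (0:ℝ)..R, ∫ θ in (-Real.pi)..Real.pi, B (r, θ) := by
        congr 2
        · have := hint A hAc
          rw [IntegrableOn, Measure.volume_eq_prod, ← Measure.prod_restrict] at this
          rw [Measure.volume_eq_prod, ← Measure.prod_restrict, integral_prod_symm _ this]
          rw [intervalIntegral.integral_of_le (by linarith [Real.pi_pos]), integral_Ioc_eq_integral_Ioo]
          simp only [intervalIntegral.integral_of_le hR0.le]
        · have := hint B hBc
          rw [IntegrableOn, Measure.volume_eq_prod, ← Measure.prod_restrict] at this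
          rw [Measure.volume_eq_prod, ← Measure.prod_restrict, integral_prod _ this]
          rw [intervalIntegral.integral_of_le hR0.le]
          simp only [intervalIntegral.integral_of_le (by linarith [Real.pi_pos] : -Real.pi ≤ Real.pi), integral_Ioc_eq_integral_Ioo]
    _ = (∫ θ in (-Real.pi)..Real.pi, - H 0) + I * ∫ r in (0:ℝ)..R, 0 := by
        congr 2
        · congr 1; ext θ
          have hd : ∀ r ∈ uIcc 0 R, HasDerivAt (fun r : ℝ => H (r * e θ)) (A (r, θ)) r := by
            intro r _
            have h1 : HasDerivAt (fun r : ℝ => (r : ℂ) * e θ) (e θ) r := by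
              simpa using (Complex.ofRealCLM.hasDerivAt (x := r)).mul_const (e θ)
            exact (hdf _).hasFDerivAt.comp_hasDerivAt r h1
          rw [intervalIntegral.integral_eq_sub_of_hasDerivAt hd
            (Continuous.intervalIntegrable (by fun_prop) _ _)]
          have : H (R * e θ) = 0 := by
            apply image_eq_zero_of_notMem_tsupport
            apply hR
            simp [hen, abs_of_pos hR0]
          simp [this]
        · apply intervalIntegral.integral_congr_ae
          filter_upwards with r hr
          rw [uIoc_of_le hR0.le] at hr
          have hr0 : (r : ℂ) ≠ 0 := by exact_mod_cast hr.1.ne'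
          have hd : ∀ θ ∈ uIcc (-Real.pi) Real.pi, HasDerivAt (fun θ : ℝ => H (r * e θ)) (r * B (r, θ)) θ := by
            intro θ _
            have h1 : HasDerivAt (fun θ : ℝ => (r : ℂ) * e θ) (r • (I * e θ)) θ := by
              have h0 : HasDerivAt (fun θ : ℝ => (θ : ℂ) * I) I θ := by
                simpa using (Complex.ofRealCLM.hasDerivAt (x := θ)).mul_const I
              have := h0.cexp.const_mul (r : ℂ)
              simpa [he, mul_comm, mul_left_comm] using this
            have := (hdf _).hasFDerivAt.comp_hasDerivAt θ h1
            rw [map_smul] at this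
            simpa [hB, Function.comp_def] using! this
          have h3 := intervalIntegral.integral_eq_sub_of_hasDerivAt hd
            (Continuous.intervalIntegrable (by fun_prop) _ _)
          rw [intervalIntegral.integral_const_mul] at h3
          have h4 : e Real.pi = e (-Real.pi) := by
            simp only [he]; push_cast
            rw [Complex.exp_pi_mul_I, neg_mul, Complex.exp_neg, Complex.exp_pi_mul_I]; norm_num
          rw [h4, sub_self] at h3
          exact (mul_eq_zero.mp h3).resolve_left hr0
    _ = _ := by
        simp only [intervalIntegral.integral_const, intervalIntegral.integral_zero, Complex.real_smul]; push_cast; ring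

lemma dbar_solve (h : ℂ → ℂ) (hh : ContDiff ℝ 1 h) (hc : HasCompactSupport h) :
    ∃ q : ℂ → ℂ, ContDiff ℝ 1 q ∧ ∀ z, fderiv ℝ q z 1 + I * fderiv ℝ q z I = h z := by
  let q := convolution (fun z : ℂ => z⁻¹) h (ContinuousLinearMap.mul ℝ ℂ) volume
  have hq : ContDiff ℝ 1 q := hc.contDiff_convolution_right (n := 1) _ locInt_inv hh
  have key : ∀ z, fderiv ℝ q z 1 + I * fderiv ℝ q z I = 2 * Real.pi * h z := by
    intro z
    have hcf : Continuous (fderiv ℝ h) := hh.continuous_fderiv (by norm_num)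
    have h1 : ∀ v, fderiv ℝ q z v = ∫ t : ℂ, t⁻¹ * fderiv ℝ h (z - t) v := by
      intro v
      rw [(hc.hasFDerivAt_convolution_right _ locInt_inv hh z).fderiv, convolution_precompR_apply _ locInt_inv (hc.fderiv ℝ) hcf, convolution_def]
      simp
    have hi : ∀ v, Integrable (fun t : ℂ => t⁻¹ * fderiv ℝ h (z - t) v) := by
      intro v
      have := HasCompactSupport.convolutionExists_right (μ := volume) (ContinuousLinearMap.mul ℝ ℂ) (f := fun z : ℂ => z⁻¹) (g := fun a => fderiv ℝ h a v) (hc.fderiv_apply ℝ v) locInt_inv (by fun_prop) z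
      simpa [ConvolutionExistsAt] using this
    have hd : ∀ t v, fderiv ℝ (fun t => h (z - t)) t v = - fderiv ℝ h (z - t) v := by
      intro t v
      have := (hh.differentiable (by norm_num) (z - t)).hasFDerivAt.comp t ((hasFDerivAt_id t).const_sub z)
      erw [this.fderiv]
      simp
    have h2 := polar_pompeiu (fun t => h (z - t)) (by fun_prop) (hc.comp_homeomorph (Homeomorph.subLeft z))
    simp only [hd, sub_zero] at h2
    rw [h1, h1, ← integral_const_mul, ← integral_add (hi _) ((hi _).const_mul _), ← neg_eq_iff_eq_neg.mpr (h2.trans (neg_mul _ _)), ← integral_neg]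
    congr 1; ext t; ring
  have hpi : (2 * Real.pi : ℂ) ≠ 0 := by simp [Real.pi_ne_zero]
  refine ⟨fun z => (2 * Real.pi : ℂ)⁻¹ * q z, by fun_prop, fun z => ?_⟩
  rw [fderiv_const_mul (hq.differentiable (by norm_num) z)]
  have := key z
  simp only [smul_apply, smul_eq_mul]
  field_simp
  linear_combination this

open Metric
open scoped Interval
lemma painleve (f : ℂ → ℂ) (c : ℂ) (r : ℝ) (hf : ContinuousOn f (ball c r))
    (hd : ∀ z ∈ ball c r, z.im ≠ 0 → DifferentiableAt ℂ f z) :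
    DifferentiableOn ℂ f (ball c r) := by
  rw [← isConservativeOn_and_continuousOn_iff_isDifferentiableOn isOpen_ball]
  refine ⟨?_, hf⟩
  have basic : ∀ z w : ℂ, [[z.re, w.re]] ×ℂ [[z.im, w.im]] ⊆ ball c r →
      (0:ℝ) ∉ Ioo (min z.im w.im) (max z.im w.im) →
      (∫ x : ℝ in z.re..w.re, f (x + z.im * I)) - (∫ x : ℝ in z.re..w.re, f (x + w.im * I)) +
      I • (∫ y : ℝ in z.im..w.im, f (re w + y * I)) -
      I • (∫ y : ℝ in z.im..w.im, f (re z + y * I)) = 0 := by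
    intro z w hzw h0
    apply integral_boundary_rect_eq_zero_of_continuousOn_of_differentiableOn f z w (hf.mono hzw)
    intro p hp
    refine (hd p (hzw ⟨Ioo_subset_Icc_self hp.1, Ioo_subset_Icc_self hp.2⟩) ?_).differentiableWithinAt
    intro h
    exact h0 (h ▸ hp.2)
  intro z w hzw
  rw [← add_eq_zero_iff_eq_neg, wedgeIntegral_add_wedgeIntegral_eq]
  by_cases h0 : (0:ℝ) ∈ Ioo (min z.im w.im) (max z.im w.im)
  · have h0' : (0:ℝ) ∈ [[z.im, w.im]] := Ioo_subset_Icc_self h0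
    have s1 : [[z.im, 0]] ⊆ [[z.im, w.im]] := uIcc_subset_uIcc_left h0'
    have s2 : [[0, w.im]] ⊆ [[z.im, w.im]] := uIcc_subset_uIcc_right h0'
    have b1 := basic z ⟨w.re, 0⟩ (fun p hp => hzw ⟨hp.1, s1 hp.2⟩) (by
      simp only [mem_Ioo, min_lt_iff, lt_max_iff]; rintro ⟨h1 | h1, h2 | h2⟩ <;> linarith)
    have b2 := basic ⟨z.re, 0⟩ w (fun p hp => hzw ⟨hp.1, s2 hp.2⟩) (by
      simp only [mem_Ioo, min_lt_iff, lt_max_iff]; rintro ⟨h1 | h1, h2 | h2⟩ <;> linarith)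
    simp only at b1 b2
    have ii : ∀ x ∈ [[z.re, w.re]], ContinuousOn (fun y : ℝ => f (x + y * I)) [[z.im, w.im]] := by
      intro x hx
      refine hf.comp (by fun_prop) ?_
      intro y hy
      apply hzw
      constructor
      · simpa using hx
      · simpa using hy
    have a1 : ∀ x ∈ [[z.re, w.re]], (∫ y : ℝ in z.im..w.im, f (x + y * I)) =
        (∫ y : ℝ in z.im..0, f (x + y * I)) + ∫ y : ℝ in 0..w.im, f (x + y * I) := by
      intro x hx
      rw [intervalIntegral.integral_add_adjacent_intervals]
      · exact ((ii x hx).mono s1).intervalIntegrable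
      · exact ((ii x hx).mono s2).intervalIntegrable
    rw [a1 _ left_mem_uIcc, a1 _ right_mem_uIcc]
    simp only [smul_eq_mul] at *
    linear_combination b1 + b2
  · exact basic z w hzw h0

lemma reg_line (φ H : ℂ → ℂ) (c : ℂ) (r : ℝ) (hr : 0 < r)
    (hφ : ContinuousOn φ (ball c r)) (hH : ContDiffOn ℝ 1 H (ball c r))
    (hd : ∀ z ∈ ball c r, z.im ≠ 0 → DifferentiableAt ℝ φ z ∧
      fderiv ℝ φ z 1 + I * fderiv ℝ φ z I = H z) :
    ContDiffAt ℝ 1 φ c := by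
  let χ : ContDiffBump c := ⟨r / 4, r / 2, by positivity, by linarith⟩
  have hrout : χ.rOut = r / 2 := rfl
  have hrin : χ.rIn = r / 4 := rfl
  let h : ℂ → ℂ := fun z => (χ z : ℂ) * H z
  have hhc : HasCompactSupport h := by
    apply HasCompactSupport.mul_right
    exact χ.hasCompactSupport.comp_left (g := fun x : ℝ => (x : ℂ)) (by simp)
  have hh : ContDiff ℝ 1 h := by
    rw [contDiff_iff_contDiffAt]
    intro z
    by_cases hz : z ∈ ball c r
    · have h1 : ContDiffAt ℝ 1 (fun z => (χ z : ℂ)) z :=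
        Complex.ofRealCLM.contDiff.contDiffAt.comp z χ.contDiffAt
      exact h1.mul (hH.contDiffAt (isOpen_ball.mem_nhds hz))
    · have : h =ᶠ[nhds z] fun _ => 0 := by
        have : (closedBall c (r / 2))ᶜ ∈ nhds z := by
          apply isClosed_closedBall.isOpen_compl.mem_nhds
          simp only [mem_ball, not_lt, mem_compl_iff, mem_closedBall, not_le] at hz ⊢
          linarith
        filter_upwards [this] with w hw
        simp only [mem_compl_iff, mem_closedBall, not_le] at hw
        simp [h, χ.zero_of_le_dist (x := w) (by rw [hrout]; linarith)]
      exact contDiffAt_const.congr_of_eventuallyEq this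
  obtain ⟨q, hq, hqe⟩ := dbar_solve h hh hhc
  have hsub : ball c (r / 4) ⊆ ball c r := ball_subset_ball (by linarith)
  have hdq := hq.differentiable (by norm_num)
  have hol : DifferentiableOn ℂ (fun z => φ z - q z) (ball c (r / 4)) := by
    apply painleve
    · exact (hφ.mono hsub).sub hq.continuous.continuousOn
    · intro z hz hz0
      obtain ⟨h1, h2⟩ := hd z (hsub hz) hz0
      rw [differentiableAt_complex_iff_differentiableAt_real]
      refine ⟨h1.sub (hdq z), ?_⟩
      rw [fderiv_fun_sub h1 (hdq z)]
      have h3 := hqe z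
      have h4 : h z = H z := by
        simp [h, χ.one_of_mem_closedBall (x := z) (by rw [hrin]; exact ball_subset_closedBall hz)]
      rw [h4, ← h2] at h3
      simp only [sub_apply, smul_eq_mul]
      linear_combination I * h3 + (fderiv ℝ φ z I - fderiv ℝ q z I) * I_mul_I
  have hc4 : ball c (r / 4) ∈ nhds c := ball_mem_nhds c (by positivity)
  have h5 : ContDiffAt ℝ 1 (fun z => φ z - q z) c := by
    have : ContDiffAt ℂ 1 (fun z => φ z - q z) c :=
      (hol.contDiffOn isOpen_ball).contDiffAt hc4
    exact this.restrict_scalars ℝ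
  have := h5.add hq.contDiffAt
  simpa using! this

open MeasureTheory Complex Metric Filter Topology
open scoped Interval

lemma cd_fderiv_apply {E : Type*} [NormedAddCommGroup E] [NormedSpace ℝ E] {F : E → ℂ} {z : E}
    (h : ContDiffAt ℝ 2 F z) (v : E) :
    ContDiffAt ℝ 1 (fun w => fderiv ℝ F w v) z :=
  (h.fderiv_right (m := 1) (by norm_num)).clm_apply contDiffAt_const

lemma fderiv_fderiv_apply {E : Type*} [NormedAddCommGroup E] [NormedSpace ℝ E] {F : E → ℂ} {z : E}
    (h : ContDiffAt ℝ 2 F z) (v w : E) :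
    fderiv ℝ (fun w => fderiv ℝ F w v) z w = fderiv ℝ (fderiv ℝ F) z w v := by
  have h1 : DifferentiableAt ℝ (fderiv ℝ F) z :=
    (h.fderiv_right (m := 1) (by norm_num)).differentiableAt (by norm_num)
  rw [fderiv_clm_apply h1 (by fun_prop)]
  simp

lemma fderiv_symm {E : Type*} [NormedAddCommGroup E] [NormedSpace ℝ E] {F : E → ℂ} {z : E}
    (h : ContDiffAt ℝ 2 F z) (v w : E) :
    fderiv ℝ (fun w => fderiv ℝ F w v) z w = fderiv ℝ (fun v => fderiv ℝ F v w) z v := by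
  rw [fderiv_fderiv_apply h, fderiv_fderiv_apply h]
  exact (h.isSymmSndFDerivAt (by simp)).eq w v

lemma phi_reg (F : ℂ → ℂ) (K c : ℂ) (r : ℝ) (hr : 0 < r) (hF : ContDiffOn ℝ 1 F (ball c r))
    (hd : ∀ z ∈ ball c r, z.im ≠ 0 → ContDiffAt ℝ 2 F z ∧
      fderiv ℝ (fun w => fderiv ℝ F w 1) z 1 + fderiv ℝ (fun w => fderiv ℝ F w I) z I
        + K * F z = 0) :
    ContDiffAt ℝ 1 (fun w => fderiv ℝ F w 1 - I * fderiv ℝ F w I) c := by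
  apply reg_line _ (fun z => -K * F z) c r hr
  · have : ContinuousOn (fderiv ℝ F) (ball c r) :=
      hF.continuousOn_fderiv_of_isOpen isOpen_ball (by norm_num)
    fun_prop
  · exact contDiffOn_const.mul hF
  · intro z hz hz0
    obtain ⟨h1, h2⟩ := hd z hz hz0
    have d1 : DifferentiableAt ℝ (fun w => fderiv ℝ F w 1) z :=
      (cd_fderiv_apply h1 1).differentiableAt (by norm_num)
    have dI : DifferentiableAt ℝ (fun w => fderiv ℝ F w I) z :=
      (cd_fderiv_apply h1 I).differentiableAt (by norm_num)
    refine ⟨d1.sub (dI.const_mul I), ?_⟩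
    rw [fderiv_fun_sub d1 (dI.const_mul I), fderiv_const_mul dI]
    simp only [sub_apply, smul_apply, smul_eq_mul]
    rw [fderiv_symm h1 I 1]
    linear_combination h2 - fderiv ℝ (fun w => fderiv ℝ F w I) z I * I_mul_I

lemma reg_C (F : ℂ → ℂ) (K c : ℂ) (r : ℝ) (hr : 0 < r) (hF : ContDiffOn ℝ 1 F (ball c r))
    (hd : ∀ z ∈ ball c r, z.im ≠ 0 → ContDiffAt ℝ 2 F z ∧
      fderiv ℝ (fun w => fderiv ℝ F w 1) z 1 + fderiv ℝ (fun w => fderiv ℝ F w I) z I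
        + K * F z = 0) :
    ContDiffAt ℝ 2 F c := by
  have p1 := phi_reg F K c r hr hF hd
  have hcj : ∀ (G : ℂ → ℂ) z v, fderiv ℝ (fun w => conjCLE (G w)) z v = conjCLE (fderiv ℝ G z v) := by
    intro G z v
    have := conjCLE.comp_fderiv (f := G) (x := z)
    have h2 := congrArg (fun L => L v) this
    simpa using! h2
  have p2 := phi_reg (fun w => conjCLE (F w)) (conjCLE K) c r hr (conjCLE.contDiff.comp_contDiffOn hF) (by
    intro z hz hz0
    obtain ⟨h1, h2⟩ := hd z hz hz0
    refine ⟨conjCLE.contDiff.contDiffAt.comp z h1, ?_⟩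
    simp only [hcj]
    have h3 := congrArg conjCLE h2
    simpa using! h3)
  simp only [hcj] at p2
  have p3 : ContDiffAt ℝ 1 (fun w => fderiv ℝ F w 1 + I * fderiv ℝ F w I) c := by
    have := conjCLE.contDiff.contDiffAt.comp c p2
    refine this.congr_of_eventuallyEq (Eventually.of_forall fun w => ?_)
    simp
  have q1 : ContDiffAt ℝ 1 (fun w => fderiv ℝ F w 1) c := by
    have := (p1.add p3).const_smul (1/2 : ℝ)
    refine this.congr_of_eventuallyEq (Eventually.of_forall fun w => ?_)
    simp only [Pi.smul_apply, Pi.add_apply, real_smul]; push_cast; ring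
  have q2 : ContDiffAt ℝ 1 (fun w => fderiv ℝ F w I) c := by
    have := ((contDiffAt_const (c := I)).mul (p1.sub p3)).const_smul (1/2 : ℝ)
    refine this.congr_of_eventuallyEq (Eventually.of_forall fun w => ?_)
    simp only [Pi.smul_apply, Pi.sub_apply, Pi.mul_apply, real_smul]; push_cast
    linear_combination fderiv ℝ F w I * I_mul_I
  rw [show (2 : WithTop ℕ∞) = ((1 : ℕ) : WithTop ℕ∞) + 1 by norm_num,
    contDiffAt_succ_iff_hasFDerivAt]
  refine ⟨fderiv ℝ F, ⟨ball c r, ball_mem_nhds c hr, fun x hx => ?_⟩, ?_⟩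
  · exact ((hF.contDiffAt (isOpen_ball.mem_nhds hx)).differentiableAt (by norm_num)).hasFDerivAt
  · have : fderiv ℝ F = fun w => reCLM.smulRight (fderiv ℝ F w 1) + imCLM.smulRight (fderiv ℝ F w I) := by
      ext w v
      have : v = v.re • (1:ℂ) + v.im • I := by simp
      conv_lhs => rw [this]
      rw [map_add, map_smul, map_smul]
      simp
    rw [this]
    have e1 : ContDiffAt ℝ 1 (fun w => reCLM.smulRight (fderiv ℝ F w 1)) c :=
      ((ContinuousLinearMap.smulRightL ℝ ℂ ℂ reCLM).contDiff.contDiffAt).comp c q1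
    have e2 : ContDiffAt ℝ 1 (fun w => imCLM.smulRight (fderiv ℝ F w I)) c :=
      ((ContinuousLinearMap.smulRightL ℝ ℂ ℂ imCLM).contDiff.contDiffAt).comp c q2
    exact e1.add e2

def lapl (f : ℝ × ℝ → ℂ) (x : ℝ × ℝ) : ℂ :=
  fderiv ℝ (fun w => fderiv ℝ f w (1, 0)) x (1, 0) + fderiv ℝ (fun w => fderiv ℝ f w (0, 1)) x (0, 1)

lemma plane_reg (f : ℝ × ℝ → ℂ) (K : ℂ) (Ω : Set (ℝ × ℝ)) (hΩ : IsOpen Ω) (hf : ContDiffOn ℝ 1 f Ω)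
    (hd : ∀ x ∈ Ω, x.2 ≠ 0 → ContDiffAt ℝ 2 f x ∧ lapl f x + K * f x = 0) :
    ContDiffOn ℝ 2 f Ω ∧ ∀ x ∈ Ω, lapl f x + K * f x = 0 := by
  have hc2 : ∀ x ∈ Ω, ContDiffAt ℝ 2 f x := by
    intro x hx
    let e := equivRealProdCLM
    have hfe : ∀ (g : ℝ × ℝ → ℂ) z v, fderiv ℝ (fun w => g (e w)) z v = fderiv ℝ g (e z) (e v) := by
      intro g z v
      have := e.comp_right_fderiv (f := g) (x := z)
      have h2 := congrArg (fun L => L v) this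
      simpa using! h2
    have ho : IsOpen (e ⁻¹' Ω) := hΩ.preimage e.continuous
    obtain ⟨r, hr, hb⟩ := Metric.isOpen_iff.mp ho (e.symm x) (by simpa using hx)
    have h1 : e 1 = (1, 0) := by simp [e]
    have hI : e I = (0, 1) := by simp [e]
    have := reg_C (fun w => f (e w)) K (e.symm x) r hr
      (hf.comp e.contDiff.contDiffOn hb) (by
        intro z hz hz0
        obtain ⟨h2, h3⟩ := hd (e z) (hb hz) (by simpa [e] using hz0)
        refine ⟨h2.comp z e.contDiff.contDiffAt, ?_⟩
        simp only [hfe, h1, hI]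
        rw [hfe (fun y => fderiv ℝ f y (1,0)), hfe (fun y => fderiv ℝ f y (0,1)), h1, hI]
        exact h3)
    have h4 := this.comp x e.symm.contDiff.contDiffAt
    simpa [Function.comp_def] using h4
  refine ⟨fun x hx => (hc2 x hx).contDiffWithinAt, fun x hx => ?_⟩
  have hcont : ContinuousAt (fun y => lapl f y + K * f y) x := by
    have := hc2 x hx
    have a1 : ContinuousAt (fderiv ℝ (fun w => fderiv ℝ f w (1, 0))) x :=
      ((cd_fderiv_apply this (1,0)).fderiv_right (m := 0) (by norm_num)).continuousAt
    have a2 : ContinuousAt (fderiv ℝ (fun w => fderiv ℝ f w (0, 1))) x :=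
      ((cd_fderiv_apply this (0,1)).fderiv_right (m := 0) (by norm_num)).continuousAt
    have a3 := this.continuousAt
    unfold lapl
    fun_prop
  by_contra hne
  have h1 := hcont.eventually_ne hne
  have h2 : ∀ᶠ y in 𝓝 x, y ∈ Ω := hΩ.mem_nhds hx
  have hdense : Dense (Prod.snd ⁻¹' ({0}ᶜ : Set ℝ) : Set (ℝ × ℝ)) :=
    (dense_compl_singleton (0:ℝ)).preimage isOpenMap_snd
  obtain ⟨y, ⟨hy1, hy2⟩, hy3⟩ := mem_closure_iff_nhds.mp (hdense x) _ (h1.and h2)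
  exact hy1 (hd y hy2 hy3).2

lemma pd1_eq {f : ℝ × ℝ → ℂ} {x : ℝ × ℝ} (h : DifferentiableAt ℝ f x) :
    pd1 f x = fderiv ℝ f x (1, 0) := by
  have h1 : HasDerivAt (fun s : ℝ => (s, x.2)) ((1:ℝ), (0:ℝ)) x.1 :=
    (hasDerivAt_id _).prodMk (hasDerivAt_const _ _)
  exact (HasFDerivAt.comp_hasDerivAt (x := x.1) (f := fun s : ℝ => (s, x.2)) (l := f) h.hasFDerivAt h1).deriv

lemma pd2_eq {f : ℝ × ℝ → ℂ} {x : ℝ × ℝ} (h : DifferentiableAt ℝ f x) :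
    pd2 f x = fderiv ℝ f x (0, 1) := by
  have h1 : HasDerivAt (fun s : ℝ => (x.1, s)) ((0:ℝ), (1:ℝ)) x.2 :=
    (hasDerivAt_const _ _).prodMk (hasDerivAt_id _)
  exact (HasFDerivAt.comp_hasDerivAt (x := x.2) (f := fun s : ℝ => (x.1, s)) (l := f) h.hasFDerivAt h1).deriv

lemma pd1_congr {f g : ℝ × ℝ → ℂ} {x : ℝ × ℝ} (h : f =ᶠ[𝓝 x] g) : pd1 f x = pd1 g x := by
  apply Filter.EventuallyEq.deriv_eq
  exact (show ContinuousAt (fun s : ℝ => (s, x.2)) x.1 by fun_prop).eventually h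

lemma pd2_congr {f g : ℝ × ℝ → ℂ} {x : ℝ × ℝ} (h : f =ᶠ[𝓝 x] g) : pd2 f x = pd2 g x := by
  apply Filter.EventuallyEq.deriv_eq
  exact (show ContinuousAt (fun s : ℝ => (x.1, s)) x.2 by fun_prop).eventually h

lemma lapl_eq {f : ℝ × ℝ → ℂ} {x : ℝ × ℝ} (h : ContDiffAt ℝ 2 f x) :
    pd1 (pd1 f) x + pd2 (pd2 f) x = lapl f x := by
  have h1 : ∀ᶠ y in 𝓝 x, DifferentiableAt ℝ f y := by
    filter_upwards [h.eventually (by simp)] with y hy using hy.differentiableAt (by norm_num)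
  rw [pd1_congr (h1.mono fun y hy => pd1_eq hy), pd2_congr (h1.mono fun y hy => pd2_eq hy),
    pd1_eq ((cd_fderiv_apply h (1,0)).differentiableAt (by norm_num)), pd2_eq ((cd_fderiv_apply h (0,1)).differentiableAt (by norm_num))]
  rfl

/-- pointwise Helmholtz -/
def Hz (K : ℂ) (f : ℝ × ℝ → ℂ) (x : ℝ × ℝ) : Prop := ContDiffAt ℝ 2 f x ∧ lapl f x + K * f x = 0

lemma Hz.congr {K : ℂ} {f g : ℝ × ℝ → ℂ} {x : ℝ × ℝ} (hf : Hz K f x) (h : g =ᶠ[𝓝 x] f) : Hz K g x := by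
  refine ⟨hf.1.congr_of_eventuallyEq h, ?_⟩
  have h1 : ∀ v, (fun w => fderiv ℝ g w v) =ᶠ[𝓝 x] (fun w => fderiv ℝ f w v) := by
    intro v
    filter_upwards [h.fderiv (𝕜 := ℝ)] with y hy
    rw [hy]
  have : lapl g x = lapl f x := by
    unfold lapl
    rw [(h1 (1,0)).fderiv_eq, (h1 (0,1)).fderiv_eq]
  rw [this, h.eq_of_nhds]
  exact hf.2

lemma Hz.add_const_mul {K c : ℂ} {f g : ℝ × ℝ → ℂ} {x : ℝ × ℝ} (hf : Hz K f x) (hg : Hz K g x) :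
    Hz K (fun y => f y + c * g y) x := by
  refine ⟨hf.1.add (contDiffAt_const.mul hg.1), ?_⟩
  have e1 : ∀ᶠ y in 𝓝 x, DifferentiableAt ℝ f y := by
    filter_upwards [hf.1.eventually (by simp)] with y hy using hy.differentiableAt (by norm_num)
  have e2 : ∀ᶠ y in 𝓝 x, DifferentiableAt ℝ g y := by
    filter_upwards [hg.1.eventually (by simp)] with y hy using hy.differentiableAt (by norm_num)
  have h1 : ∀ v, (fun w => fderiv ℝ (fun y => f y + c * g y) w v) =ᶠ[𝓝 x] (fun w => fderiv ℝ f w v + c * fderiv ℝ g w v) := by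
    intro v
    filter_upwards [e1, e2] with y h1 h2
    rw [fderiv_fun_add h1 (h2.const_mul c), fderiv_const_mul h2]
    simp
  have h2 : ∀ v w, fderiv ℝ (fun w => fderiv ℝ (fun y => f y + c * g y) w v) x w = fderiv ℝ (fun w => fderiv ℝ f w v) x w + c * fderiv ℝ (fun w => fderiv ℝ g w v) x w := by
    intro v w
    have d1 := (cd_fderiv_apply hf.1 v).differentiableAt (by norm_num)
    have d2 := (cd_fderiv_apply hg.1 v).differentiableAt (by norm_num)
    rw [(h1 v).fderiv_eq, fderiv_fun_add d1 (d2.const_mul c), fderiv_const_mul d2]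
    simp
  have a1 := hf.2
  have a2 := hg.2
  unfold lapl at a1 a2 ⊢
  rw [h2, h2]
  linear_combination a1 + c * a2

lemma Hz.reflect {K : ℂ} {f : ℝ × ℝ → ℂ} {x : ℝ × ℝ} (hf : Hz K f (x.1, -x.2)) :
    Hz K (fun y => f (y.1, -y.2)) x := by
  let e : (ℝ × ℝ) ≃L[ℝ] (ℝ × ℝ) := (ContinuousLinearEquiv.refl ℝ ℝ).prodCongr (ContinuousLinearEquiv.neg ℝ)
  have hfe : ∀ (g : ℝ × ℝ → ℂ) z v, fderiv ℝ (fun w => g (e w)) z v = fderiv ℝ g (e z) (e v) := by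
    intro g z v
    have := e.comp_right_fderiv (f := g) (x := z)
    have h2 := congrArg (fun L => L v) this
    simpa using! h2
  have h1 : e (1, 0) = (1, 0) := by simp [e]
  have hI : e (0, 1) = -(0, 1) := by simp [e]
  change Hz K (fun y => f (e y)) x
  change Hz K f (e x) at hf
  refine ⟨hf.1.comp x e.contDiff.contDiffAt, ?_⟩
  rw [← hf.2]
  unfold lapl
  simp only [hfe, h1, hI]
  rw [hfe (fun y => fderiv ℝ f y (1,0)), h1, hfe (fun y => fderiv ℝ f y (-(0,1))), hI]
  simp only [map_neg]
  rw [fderiv_fun_neg]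
  simp

lemma C1_of_partials {f F1 F2 : ℝ × ℝ → ℂ} {Q : Set (ℝ × ℝ)} (hQ : IsOpen Q)
    (h1 : ContinuousOn F1 Q) (h2 : ContinuousOn F2 Q)
    (d1 : ∀ p ∈ Q, HasDerivAt (fun s : ℝ => f (s, p.2)) (F1 p) p.1)
    (d2 : ∀ p ∈ Q, HasDerivAt (fun s : ℝ => f (p.1, s)) (F2 p) p.2) :
    ∃ f' : ℝ × ℝ → (ℝ × ℝ →L[ℝ] ℂ), (∀ p ∈ Q, HasFDerivAt f (f' p) p) ∧
      (∀ p, f' p = ContinuousLinearMap.smulRightL ℝ (ℝ × ℝ) ℂ (ContinuousLinearMap.fst ℝ ℝ ℝ) (F1 p) + ContinuousLinearMap.smulRightL ℝ (ℝ × ℝ) ℂ (ContinuousLinearMap.snd ℝ ℝ ℝ) (F2 p)) ∧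
      ContDiffOn ℝ 1 f Q := by
  let f' : ℝ × ℝ → (ℝ × ℝ →L[ℝ] ℂ) := fun p => ContinuousLinearMap.smulRightL ℝ (ℝ × ℝ) ℂ (ContinuousLinearMap.fst ℝ ℝ ℝ) (F1 p) + ContinuousLinearMap.smulRightL ℝ (ℝ × ℝ) ℂ (ContinuousLinearMap.snd ℝ ℝ ℝ) (F2 p)
  have key : ∀ p ∈ Q, HasFDerivAt f (f' p) p := by
    intro p hp
    have hn : Q ∈ 𝓝 p := hQ.mem_nhds hp
    have := hasStrictFDerivAt_uncurry_coprod (𝕜 := ℝ) (u := p) (f := fun x y => f (x, y))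
      (f₁ := fun x y => ContinuousLinearMap.toSpanSingleton ℝ (F1 (x, y)))
      (f₂ := fun x y => ContinuousLinearMap.toSpanSingleton ℝ (F2 (x, y)))
      (by filter_upwards [hn] with q hq using (d1 q hq).hasFDerivAt)
      (by filter_upwards [hn] with q hq using (d2 q hq).hasFDerivAt)
      ((ContinuousLinearMap.toSpanSingletonCLE (𝕜 := ℝ) (E := ℂ)).continuous.continuousAt.comp (h1.continuousAt hn))
      ((ContinuousLinearMap.toSpanSingletonCLE (𝕜 := ℝ) (E := ℂ)).continuous.continuousAt.comp (h2.continuousAt hn))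
    have h3 := this.hasFDerivAt
    refine h3.congr_fderiv ?_
    ext <;> simp [f', Function.HasUncurry.uncurry]
  refine ⟨f', key, fun p => rfl, ?_⟩
  have hc : ContinuousOn f' Q := by
    refine ContinuousOn.add ?_ ?_
    · exact (ContinuousLinearMap.continuous _).comp_continuousOn h1
    · exact (ContinuousLinearMap.continuous _).comp_continuousOn h2
  intro p hp
  apply ContDiffAt.contDiffWithinAt
  rw [contDiffAt_one_iff]
  exact ⟨f', Q, hQ.mem_nhds hp, hc, key⟩

lemma C2_of_partials {f F1 F2 : ℝ × ℝ → ℂ} {Q : Set (ℝ × ℝ)} (hQ : IsOpen Q)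
    (h1 : ContDiffOn ℝ 1 F1 Q) (h2 : ContDiffOn ℝ 1 F2 Q)
    (d1 : ∀ p ∈ Q, HasDerivAt (fun s : ℝ => f (s, p.2)) (F1 p) p.1)
    (d2 : ∀ p ∈ Q, HasDerivAt (fun s : ℝ => f (p.1, s)) (F2 p) p.2) :
    ContDiffOn ℝ 2 f Q := by
  obtain ⟨f', k1, k2, -⟩ := C1_of_partials hQ h1.continuousOn h2.continuousOn d1 d2
  intro p hp
  apply ContDiffAt.contDiffWithinAt
  rw [show (2 : WithTop ℕ∞) = ((1 : ℕ) : WithTop ℕ∞) + 1 by norm_num,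
    contDiffAt_succ_iff_hasFDerivAt]
  have hn : Q ∈ 𝓝 p := hQ.mem_nhds hp
  refine ⟨f', ⟨Q, hn, k1⟩, ?_⟩
  rw [funext k2]
  refine ContDiffAt.add ?_ ?_
  · exact (ContinuousLinearMap.contDiff _).contDiffAt.comp p (h1.contDiffAt hn)
  · exact (ContinuousLinearMap.contDiff _).contDiffAt.comp p (h2.contDiffAt hn)

lemma hasDerivAt_glue {f g : ℝ → ℂ} {d : ℝ} (hd : 0 < d) (hf : ContinuousAt f 0) (hg : ContinuousAt g 0)
    (h1 : ∀ y ∈ Ioo 0 d, HasDerivAt f (g y) y) (h2 : ∀ y ∈ Ioo (-d) 0, HasDerivAt f (g y) y) :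
    HasDerivAt f (g 0) 0 := by
  have n1 : Ioo 0 d ∈ 𝓝[>] (0:ℝ) := Ioo_mem_nhdsGT hd
  have n2 : Ioo (-d) 0 ∈ 𝓝[<] (0:ℝ) := Ioo_mem_nhdsLT (by linarith)
  have a := hasDerivWithinAt_Ici_of_tendsto_deriv (s := Ioo 0 d) (f := f) (e := g 0)
    (fun y hy => (h1 y hy).differentiableAt.differentiableWithinAt) hf.continuousWithinAt n1
    ((hg.tendsto.mono_left nhdsWithin_le_nhds).congr' (by filter_upwards [n1] with y hy using (h1 y hy).deriv.symm))
  have b := hasDerivWithinAt_Iic_of_tendsto_deriv (s := Ioo (-d) 0) (f := f) (e := g 0)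
    (fun y hy => (h2 y hy).differentiableAt.differentiableWithinAt) hf.continuousWithinAt n2
    ((hg.tendsto.mono_left nhdsWithin_le_nhds).congr' (by filter_upwards [n2] with y hy using (h2 y hy).deriv.symm))
  have := a.union b
  rwa [Ici_union_Iic, hasDerivWithinAt_univ] at this

lemma dx_int {f g D : ℝ × ℝ → ℂ} {f' g' : ℝ × ℝ → ℝ × ℝ →L[ℝ] ℂ} {α β d : ℝ}
    (hf : Continuous f) (hg : Continuous g) (hD : Continuous D)
    (hf' : ∀ p ∈ Ioo α β ×ˢ Ioo 0 d, HasFDerivAt f (f' p) p)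
    (hg' : ∀ p ∈ Ioo α β ×ˢ Ioo 0 d, HasFDerivAt g (g' p) p)
    (hDe : ∀ p ∈ Ioo α β ×ˢ Ioo 0 d, f' p (1, 0) + g' p (0, 1) = D p)
    (g0 : ∀ t, g (t, 0) = 0) {x y : ℝ} (hx : x ∈ Ioo α β) (hy : y ∈ Ioo 0 d) :
    HasDerivAt (fun t => ∫ s in (0:ℝ)..y, f (t, s)) ((∫ s in (0:ℝ)..y, D (x, s)) - g (x, y)) x := by
  classical
  have key : ∀ t ∈ Ioo α β, (∫ s in (0:ℝ)..y, f (t, s)) =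
      (∫ s in (0:ℝ)..y, f (x, s)) + ∫ r in x..t, ((∫ s in (0:ℝ)..y, D (r, s)) - g (r, y)) := by
    intro t ht
    let P := Ioo α β ×ˢ Ioo 0 d
    have hsub : Ioo (min x t) (max x t) ×ˢ Ioo (min 0 y) (max 0 y) ⊆ P := by
      rw [min_eq_left hy.1.le, max_eq_right hy.1.le]
      refine prod_mono ?_ ?_
      · intro r hr
        exact ⟨lt_of_le_of_lt (le_min hx.1.le ht.1.le) hr.1, lt_of_lt_of_le hr.2 (max_le hx.2.le ht.2.le)⟩
      · exact Ioo_subset_Ioo_right hy.2.le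
    let F : ℝ × ℝ → ℝ × ℝ →L[ℝ] ℂ := fun p => if p ∈ P then f' p else (ContinuousLinearMap.fst ℝ ℝ ℝ).smulRight (D p)
    let G : ℝ × ℝ → ℝ × ℝ →L[ℝ] ℂ := fun p => if p ∈ P then g' p else 0
    have hFG : ∀ p, F p (1, 0) + G p (0, 1) = D p := by
      intro p
      by_cases hp : p ∈ P
      · simpa [F, G, hp] using! hDe p hp
      · simp [F, G, hp]
    have := integral2_divergence_prod_of_hasFDerivAt f g F G x 0 t y hf.continuousOn hg.continuousOn
      (fun p hp => by simpa [F, hsub hp] using! hf' p (hsub hp))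
      (fun p hp => by simpa [G, hsub hp] using! hg' p (hsub hp))
      (by
        simp only [hFG]
        exact hD.continuousOn.integrableOn_compact (isCompact_uIcc.prod isCompact_uIcc))
    simp only [hFG, g0] at this
    rw [intervalIntegral.integral_sub, this]
    · simp; ring
    · apply Continuous.intervalIntegrable
      exact intervalIntegral.continuous_parametric_intervalIntegral_of_continuous (f := fun r s => D (r, s)) hD continuous_const
    · apply Continuous.intervalIntegrable
      fun_prop
  have hc : Continuous (fun r => ((∫ s in (0:ℝ)..y, D (r, s)) - g (r, y))) := by
    have := intervalIntegral.continuous_parametric_intervalIntegral_of_continuous (μ := volume) (a₀ := 0) (f := fun r s => D (r, s)) hD (s := fun _ => y) continuous_const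
    fun_prop
  have h1 := (intervalIntegral.integral_hasDerivAt_right (hc.intervalIntegrable x x)
    (hc.stronglyMeasurableAtFilter _ _) hc.continuousAt).const_add (∫ s in (0:ℝ)..y, f (x, s))
  refine h1.congr_of_eventuallyEq ?_
  filter_upwards [Ioo_mem_nhds hx.1 hx.2] with t ht using key t ht

lemma dx_bdry {U G : ℝ × ℝ → ℂ} {α β d : ℝ} (hd : 0 < d) (hU : Continuous U) (hG : Continuous G)
    (h : ∀ p ∈ Ioo α β ×ˢ Ioo 0 d, HasDerivAt (fun s => U (s, p.2)) (G p) p.1) {x : ℝ} (hx : x ∈ Ioo α β) :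
    HasDerivAt (fun s => U (s, 0)) (G (x, 0)) x := by
  have key : ∀ t ∈ Ioo α β, U (t, 0) = U (x, 0) + ∫ r in x..t, G (r, 0) := by
    intro t ht
    have h1 : ∀ y ∈ Ioo 0 d, U (t, y) = U (x, y) + ∫ r in x..t, G (r, y) := by
      intro y hy
      rw [intervalIntegral.integral_eq_sub_of_hasDerivAt (f := fun s => U (s, y))]
      · ring
      · intro r hr
        exact h (r, y) ⟨(convex_Ioo α β).ordConnected.uIcc_subset hx ht hr, hy⟩
      · apply Continuous.intervalIntegrable
        fun_prop
    have c1 : Continuous (fun y => U (t, y)) := by fun_prop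
    have c2 : Continuous (fun y => U (x, y) + ∫ r in x..t, G (r, y)) := by
      have := intervalIntegral.continuous_parametric_intervalIntegral_of_continuous' (μ := volume) (f := fun y r => G (r, y)) (by fun_prop) x t
      fun_prop
    have n : Ioo 0 d ∈ 𝓝[>] (0:ℝ) := Ioo_mem_nhdsGT hd
    refine tendsto_nhds_unique (f := fun y => U (t, y)) (l := 𝓝[>] (0:ℝ)) (c1.continuousAt.tendsto.mono_left nhdsWithin_le_nhds) ?_
    refine ((c2.continuousAt (x := 0)).tendsto.mono_left nhdsWithin_le_nhds).congr' ?_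
    filter_upwards [n] with y hy using (h1 y hy).symm
  have hc : Continuous (fun r => G (r, 0)) := by fun_prop
  have h1 := (intervalIntegral.integral_hasDerivAt_right (hc.intervalIntegrable x x)
    (hc.stronglyMeasurableAtFilter _ _) hc.continuousAt).const_add (U (x, 0))
  refine h1.congr_of_eventuallyEq ?_
  filter_upwards [Ioo_mem_nhds hx.1 hx.2] with t ht using key t ht

lemma fd_exp (c : ℂ) (p : ℝ × ℝ) : HasFDerivAt (fun p : ℝ × ℝ => cexp (-(c * (p.2 : ℂ))))
    ((-c * cexp (-(c * (p.2 : ℂ)))) • (Complex.ofRealCLM.comp (ContinuousLinearMap.snd ℝ ℝ ℝ))) p := by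
  have h : HasFDerivAt (fun p : ℝ × ℝ => (p.2 : ℂ)) (Complex.ofRealCLM.comp (ContinuousLinearMap.snd ℝ ℝ ℝ)) p :=
    (Complex.ofRealCLM.comp (ContinuousLinearMap.snd ℝ ℝ ℝ)).hasFDerivAt
  have := ((h.const_mul c).neg).cexp
  refine this.congr_fderiv ?_
  ext <;> simp ; ring

/-- the weighted primitive -/
def Jint (a : ℂ) (g : ℝ × ℝ → ℂ) (p : ℝ × ℝ) : ℂ := ∫ s in (0:ℝ)..p.2, cexp (-(a * (s : ℂ))) * g (p.1, s)

lemma Jint_cont (a : ℂ) {g : ℝ × ℝ → ℂ} (hg : Continuous g) : Continuous (Jint a g) := by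
  unfold Jint
  exact intervalIntegral.continuous_parametric_intervalIntegral_of_continuous (f := fun (p : ℝ × ℝ) s => cexp (-(a * (s : ℂ))) * g (p.1, s)) (by fun_prop) continuous_snd

lemma Jint_dy (a : ℂ) {g : ℝ × ℝ → ℂ} (hg : Continuous g) (x y : ℝ) :
    HasDerivAt (fun s => Jint a g (x, s)) (cexp (-(a * (y : ℂ))) * g (x, y)) y := by
  unfold Jint
  have hc : Continuous (fun s : ℝ => cexp (-(a * (s : ℂ))) * g (x, s)) := by fun_prop
  exact intervalIntegral.integral_hasDerivAt_right (hc.intervalIntegrable 0 y)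
    (hc.stronglyMeasurableAtFilter _ _) hc.continuousAt

/-- exp times weighted primitive -/
def Wint (a : ℂ) (g : ℝ × ℝ → ℂ) (p : ℝ × ℝ) : ℂ := cexp (a * (p.2 : ℂ)) * Jint a g p

lemma Wint_cont (a : ℂ) {g : ℝ × ℝ → ℂ} (hg : Continuous g) : Continuous (Wint a g) := by
  have := Jint_cont a hg
  unfold Wint
  fun_prop

lemma Wint_zero (a : ℂ) (g : ℝ × ℝ → ℂ) (x : ℝ) : Wint a g (x, 0) = 0 := by
  simp [Wint, Jint]

lemma Wint_dy (a : ℂ) {g : ℝ × ℝ → ℂ} (hg : Continuous g) (x y : ℝ) :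
    HasDerivAt (fun s => Wint a g (x, s)) (a * Wint a g (x, y) + g (x, y)) y := by
  unfold Wint
  have h1 : HasDerivAt (fun s : ℝ => cexp (a * (s : ℂ))) (cexp (a * (y : ℂ)) * (a * 1)) y :=
    ((Complex.ofRealCLM.hasDerivAt (x := y)).const_mul a).cexp
  refine (h1.mul (Jint_dy a hg x y)).congr_deriv ?_
  have : cexp (a * (y : ℂ)) * cexp (-(a * (y : ℂ))) = 1 := by rw [← Complex.exp_add]; simp
  linear_combination g (x, y) * this

lemma Wint_dx (a : ℂ) {g h D : ℝ × ℝ → ℂ} {g' h' : ℝ × ℝ → ℝ × ℝ →L[ℝ] ℂ} {α β d : ℝ}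
    (hg : Continuous g) (hh : Continuous h) (hD : Continuous D)
    (hg' : ∀ p ∈ Ioo α β ×ˢ Ioo 0 d, HasFDerivAt g (g' p) p)
    (hh' : ∀ p ∈ Ioo α β ×ˢ Ioo 0 d, HasFDerivAt h (h' p) p)
    (hDe : ∀ p ∈ Ioo α β ×ˢ Ioo 0 d, g' p (1, 0) + h' p (0, 1) - a * h p = D p)
    (g0 : ∀ t, h (t, 0) = 0) {x y : ℝ} (hx : x ∈ Ioo α β) (hy : y ∈ Ioo 0 d) :
    HasDerivAt (fun t => Wint a g (t, y)) (Wint a D (x, y) - h (x, y)) x := by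
  have := dx_int (f := fun p => cexp (-(a * (p.2 : ℂ))) * g p) (g := fun p => cexp (-(a * (p.2 : ℂ))) * h p)
    (D := fun p => cexp (-(a * (p.2 : ℂ))) * D p)
    (by fun_prop) (by fun_prop) (by fun_prop)
    (fun p hp => (fd_exp a p).mul (hg' p hp)) (fun p hp => (fd_exp a p).mul (hh' p hp))
    (fun p hp => by
      rw [← hDe p hp]
      simp
      ring) (fun t => by simp [g0]) hx hy
  refine (this.const_mul (cexp (a * (y : ℂ)))).congr_deriv ?_
  unfold Wint Jint
  have : cexp (a * (y : ℂ)) * cexp (-(a * (y : ℂ))) = 1 := by rw [← Complex.exp_add]; simp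
  simp only
  linear_combination - h (x, y) * this

lemma Wint_const_mul (a c : ℂ) (g : ℝ × ℝ → ℂ) (p : ℝ × ℝ) : Wint a (fun q => c * g q) p = c * Wint a g p := by
  unfold Wint Jint
  have : ∀ s : ℝ, cexp (-(a * (s : ℂ))) * (c * g (p.1, s)) = c * (cexp (-(a * (s : ℂ))) * g (p.1, s)) := by
    intro s; ring
  simp only [this, intervalIntegral.integral_const_mul]
  ring

lemma W_facts (a K : ℂ) {U G1 G2 : ℝ × ℝ → ℂ} {α β d : ℝ}
    (hU : Continuous U) (hG1 : Continuous G1) (hG2 : Continuous G2)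
    (hbc : ∀ x, G2 (x, 0) + a * U (x, 0) = 0)
    (h2 : ∀ p ∈ Ioo α β ×ˢ Ioo 0 d, Hz K U p)
    (e1 : ∀ p ∈ Ioo α β ×ˢ Ioo 0 d, fderiv ℝ U p (1, 0) = G1 p)
    (e2 : ∀ p ∈ Ioo α β ×ˢ Ioo 0 d, fderiv ℝ U p (0, 1) = G2 p) :
    (∀ p ∈ Ioo α β ×ˢ Ioo 0 d, HasDerivAt (fun s => Wint a U (s, p.2)) (Wint a G1 p) p.1) ∧
    ∀ p ∈ Ioo α β ×ˢ Ioo 0 d, Hz K (Wint a U) p := by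
  have hP : IsOpen (Ioo α β ×ˢ Ioo 0 d) := isOpen_Ioo.prod isOpen_Ioo
  have dU : ∀ p ∈ Ioo α β ×ˢ Ioo 0 d, DifferentiableAt ℝ U p := fun p hp =>
    (h2 p hp).1.differentiableAt (by norm_num)
  have c1 : ∀ p ∈ Ioo α β ×ˢ Ioo 0 d, (fun w => fderiv ℝ U w (1, 0)) =ᶠ[𝓝 p] G1 := fun p hp => by
    filter_upwards [hP.mem_nhds hp] with q hq using e1 q hq
  have c2 : ∀ p ∈ Ioo α β ×ˢ Ioo 0 d, (fun w => fderiv ℝ U w (0, 1)) =ᶠ[𝓝 p] G2 := fun p hp => by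
    filter_upwards [hP.mem_nhds hp] with q hq using e2 q hq
  have dG1 : ∀ p ∈ Ioo α β ×ˢ Ioo 0 d, DifferentiableAt ℝ G1 p := fun p hp =>
    ((cd_fderiv_apply (h2 p hp).1 (1, 0)).congr_of_eventuallyEq (c1 p hp).symm).differentiableAt (by norm_num)
  have dG2 : ∀ p ∈ Ioo α β ×ˢ Ioo 0 d, DifferentiableAt ℝ G2 p := fun p hp =>
    ((cd_fderiv_apply (h2 p hp).1 (0, 1)).congr_of_eventuallyEq (c2 p hp).symm).differentiableAt (by norm_num)
  have lap : ∀ p ∈ Ioo α β ×ˢ Ioo 0 d, fderiv ℝ G1 p (1, 0) + fderiv ℝ G2 p (0, 1) + K * U p = 0 := by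
    intro p hp
    rw [← (h2 p hp).2, lapl, (c1 p hp).fderiv_eq, (c2 p hp).fderiv_eq]
  have A1 : ∀ p ∈ Ioo α β ×ˢ Ioo 0 d, HasDerivAt (fun s => Wint a U (s, p.2)) (Wint a G1 p) p.1 := by
    intro p hp
    have := Wint_dx a (g := U) (h := fun _ => 0) (D := G1) (g' := fun p => fderiv ℝ U p) (h' := fun _ => 0)
      hU continuous_const hG1 (fun p hp => (dU p hp).hasFDerivAt) (fun p hp => hasFDerivAt_const _ _)
      (fun p hp => by simp [e1 p hp]) (fun _ => rfl) hp.1 hp.2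
    simpa using this
  have A2 : ∀ p ∈ Ioo α β ×ˢ Ioo 0 d, HasDerivAt (fun s => Wint a G1 (s, p.2))
      (-(K + a ^ 2) * Wint a U p - (G2 p + a * U p)) p.1 := by
    intro p hp
    have := Wint_dx a (g := G1) (h := fun p => G2 p + a * U p) (D := fun p => -(K + a ^ 2) * U p)
      (g' := fun p => fderiv ℝ G1 p) (h' := fun p => fderiv ℝ G2 p + a • fderiv ℝ U p)
      hG1 (by fun_prop) (by fun_prop) (fun p hp => (dG1 p hp).hasFDerivAt)
      (fun p hp => (dG2 p hp).hasFDerivAt.add ((dU p hp).hasFDerivAt.const_mul a))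
      (fun p hp => by
        simp [e2 p hp]
        linear_combination lap p hp) hbc hp.1 hp.2
    rwa [Wint_const_mul] at this
  have hW := Wint_cont a hU
  have hW1 := Wint_cont a hG1
  obtain ⟨-, -, -, W1C⟩ := C1_of_partials (f := Wint a G1) hP
    (F1 := fun p => -(K + a ^ 2) * Wint a U p - (G2 p + a * U p))
    (F2 := fun p => a * Wint a G1 p + G1 p) (by fun_prop) (by fun_prop) A2 (fun p _ => Wint_dy a hG1 p.1 p.2)
  obtain ⟨-, -, -, WC⟩ := C1_of_partials (f := Wint a U) hP
    (F1 := Wint a G1)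
    (F2 := fun p => a * Wint a U p + U p) (by fun_prop) (by fun_prop) A1 (fun p _ => Wint_dy a hU p.1 p.2)
  have WC2 := C2_of_partials (f := Wint a U) hP
    (F1 := Wint a G1)
    (F2 := fun p => a * Wint a U p + U p) W1C
    ((contDiffOn_const.mul WC).add (fun p hp => ((h2 p hp).1.of_le (by norm_num)).contDiffWithinAt))
    A1 (fun p _ => Wint_dy a hU p.1 p.2)
  refine ⟨A1, fun p hp => ⟨WC2.contDiffAt (hP.mem_nhds hp), ?_⟩⟩
  rw [← lapl_eq (WC2.contDiffAt (hP.mem_nhds hp))]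
  have q1 : pd1 (Wint a U) =ᶠ[𝓝 p] Wint a G1 := by
    filter_upwards [hP.mem_nhds hp] with q hq using (A1 q hq).deriv
  have q2 : pd2 (Wint a U) = fun q => a * Wint a U q + U q := by
    funext q
    exact (Wint_dy a hU q.1 q.2).deriv
  have r1 : pd1 (Wint a G1) p = _ := (A2 p hp).deriv
  have r2 : pd2 (fun q => a * Wint a U q + U q) p = a * (a * Wint a U p + U p) + G2 p := by
    refine HasDerivAt.deriv ?_
    refine ((Wint_dy a hU p.1 p.2).const_mul a).add ?_
    rw [← e2 p hp]
    have := (dU p hp).hasFDerivAt.comp_hasDerivAt (f := fun s : ℝ => (p.1, s)) (p.2)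
      ((hasDerivAt_const p.2 p.1).prodMk (hasDerivAt_id p.2))
    exact this
  rw [pd1_congr q1, q2, r1, r2]
  ring

lemma local_rect (a K : ℂ) {U G1 G2 : ℝ × ℝ → ℂ} {α β d : ℝ} (hd : 0 < d)
    (hU : Continuous U) (hG1 : Continuous G1) (hG2 : Continuous G2)
    (hbc : ∀ x, G2 (x, 0) + a * U (x, 0) = 0)
    (h2 : ∀ p ∈ Ioo α β ×ˢ Ioo 0 d, Hz K U p)
    (e1 : ∀ p ∈ Ioo α β ×ˢ Ioo 0 d, fderiv ℝ U p (1, 0) = G1 p)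
    (e2 : ∀ p ∈ Ioo α β ×ˢ Ioo 0 d, fderiv ℝ U p (0, 1) = G2 p) :
    ∀ p ∈ Ioo α β ×ˢ Ioo (-d) d,
      Hz K (fun p => if 0 ≤ p.2 then U p else U (p.1, -p.2) + 2 * a * Wint a U (p.1, -p.2)) p := by
  obtain ⟨A1, HW⟩ := W_facts a K hU hG1 hG2 hbc h2 e1 e2
  have hW := Wint_cont a hU
  have hW1 := Wint_cont a hG1
  have hQ : IsOpen (Ioo α β ×ˢ Ioo (-d) d) := isOpen_Ioo.prod isOpen_Ioo
  have dU : ∀ p ∈ Ioo α β ×ˢ Ioo 0 d, DifferentiableAt ℝ U p := fun p hp =>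
    (h2 p hp).1.differentiableAt (by norm_num)
  have U1 : ∀ p ∈ Ioo α β ×ˢ Ioo 0 d, HasDerivAt (fun s => U (s, p.2)) (G1 p) p.1 := by
    intro p hp
    rw [← e1 p hp]
    exact (dU p hp).hasFDerivAt.comp_hasDerivAt (f := fun s : ℝ => (s, p.2)) (p.1)
      ((hasDerivAt_id p.1).prodMk (hasDerivAt_const p.1 p.2))
  have U2 : ∀ p ∈ Ioo α β ×ˢ Ioo 0 d, HasDerivAt (fun s => U (p.1, s)) (G2 p) p.2 := by
    intro p hp
    rw [← e2 p hp]
    exact (dU p hp).hasFDerivAt.comp_hasDerivAt (f := fun s : ℝ => (p.1, s)) (p.2)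
      ((hasDerivAt_const p.2 p.1).prodMk (hasDerivAt_id p.2))
  set f : ℝ × ℝ → ℂ := fun p => if 0 ≤ p.2 then U p else U (p.1, -p.2) + 2 * a * Wint a U (p.1, -p.2) with hf
  let F1 : ℝ × ℝ → ℂ := fun p => if 0 ≤ p.2 then G1 p else G1 (p.1, -p.2) + 2 * a * Wint a G1 (p.1, -p.2)
  let F2 : ℝ × ℝ → ℂ := fun p => if 0 ≤ p.2 then G2 p else
    -(G2 (p.1, -p.2) + 2 * a * (a * Wint a U (p.1, -p.2) + U (p.1, -p.2)))
  have fc : Continuous f := by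
    refine Continuous.if_le (by fun_prop) (by fun_prop) continuous_const continuous_snd ?_
    rintro ⟨x, y⟩ h
    simp only at h
    subst h
    simp [Wint_zero]
  have F1c : Continuous F1 := by
    refine Continuous.if_le (by fun_prop) (by fun_prop) continuous_const continuous_snd ?_
    rintro ⟨x, y⟩ h
    simp only at h
    subst h
    simp [Wint_zero]
  have F2c : Continuous F2 := by
    refine Continuous.if_le (by fun_prop) (by fun_prop) continuous_const continuous_snd ?_
    rintro ⟨x, y⟩ h
    simp only at h
    subst h
    simp [Wint_zero]
    linear_combination 2 * hbc x
  have d1 : ∀ p ∈ Ioo α β ×ˢ Ioo (-d) d, HasDerivAt (fun s : ℝ => f (s, p.2)) (F1 p) p.1 := by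
    rintro ⟨x, y⟩ ⟨hx, hy⟩
    simp only at hx hy
    rcases lt_trichotomy y 0 with h | h | h
    · have m : ((x, -y) : ℝ × ℝ) ∈ Ioo α β ×ˢ Ioo 0 d := ⟨hx, by simp; constructor <;> linarith [hy.1]⟩
      simp only [hf, F1, not_le.2 h, if_false]
      exact (U1 _ m).add ((A1 _ m).const_mul _)
    · subst h
      simp only [hf, F1, le_refl, if_true]
      exact dx_bdry hd hU hG1 U1 hx
    · simp only [hf, F1, h.le, if_true]
      exact U1 (x, y) ⟨hx, h, hy.2⟩
  have d2pos : ∀ x ∈ Ioo α β, ∀ y ∈ Ioo 0 d, HasDerivAt (fun s : ℝ => f (x, s)) (F2 (x, y)) y := by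
    intro x hx y hy
    have := U2 (x, y) ⟨hx, hy⟩
    simp only [F2, hy.1.le, if_true]
    refine this.congr_of_eventuallyEq ?_
    filter_upwards [Ioi_mem_nhds hy.1] with s hs
    simp [hf, (mem_Ioi.1 hs).le]
  have d2neg : ∀ x ∈ Ioo α β, ∀ y ∈ Ioo (-d) 0, HasDerivAt (fun s : ℝ => f (x, s)) (F2 (x, y)) y := by
    intro x hx y hy
    have m : ((x, -y) : ℝ × ℝ) ∈ Ioo α β ×ˢ Ioo 0 d := ⟨hx, by simp; constructor <;> linarith [hy.1, hy.2]⟩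
    have := (U2 _ m).add ((Wint_dy a hU x (-y)).const_mul (2 * a))
    have h3 := HasDerivAt.scomp (h := fun s : ℝ => -s) y this (hasDerivAt_neg y)
    simp only [F2, not_le.2 hy.2, if_false]
    refine (h3.congr_of_eventuallyEq ?_).congr_deriv (by simp; ring)
    filter_upwards [Iio_mem_nhds hy.2] with s hs
    simp [hf, not_le.2 (mem_Iio.1 hs)]
  have d2 : ∀ p ∈ Ioo α β ×ˢ Ioo (-d) d, HasDerivAt (fun s : ℝ => f (p.1, s)) (F2 p) p.2 := by
    rintro ⟨x, y⟩ ⟨hx, hy⟩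
    simp only at hx hy
    rcases lt_trichotomy y 0 with h | h | h
    · exact d2neg x hx y ⟨hy.1, h⟩
    · subst h
      exact hasDerivAt_glue (f := fun s : ℝ => f (x, s)) (g := fun s : ℝ => F2 (x, s)) hd
        (by fun_prop) (by fun_prop) (d2pos x hx) (d2neg x hx)
    · exact d2pos x hx y ⟨h, hy.2⟩
  obtain ⟨-, -, -, fC⟩ := C1_of_partials hQ F1c.continuousOn F2c.continuousOn d1 d2
  have fin := plane_reg f K _ hQ fC (by
    rintro ⟨x, y⟩ ⟨hx, hy⟩ h0
    simp only at hx hy h0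
    change Hz K f (x, y)
    rcases lt_or_gt_of_ne h0 with h | h
    · have m : ((x, -y) : ℝ × ℝ) ∈ Ioo α β ×ˢ Ioo 0 d := ⟨hx, by simp; constructor <;> linarith [hy.1]⟩
      have := Hz.reflect (x := (x, y)) (Hz.add_const_mul (c := 2 * a) (h2 _ m) (HW _ m))
      refine this.congr ?_
      filter_upwards [(continuous_snd.tendsto (x, y)).eventually (Iio_mem_nhds h)] with q hq
      simp [hf, not_le.2 hq]
    · refine (h2 (x, y) ⟨hx, h, hy.2⟩).congr ?_
      filter_upwards [(continuous_snd.tendsto (x, y)).eventually (Ioi_mem_nhds h)] with q hq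
      simp [hf, hq.le])
  exact fun p hp => ⟨fin.1.contDiffAt (hQ.mem_nhds hp), fin.2 p hp⟩

lemma hz_at (k lam : ℂ) (Ω : Set (ℝ × ℝ)) (hΩo : IsOpen Ω)
    (hsym : SymmetricWrtL Ω) (hcol : ColumnCond Ω)
    (u g1 g2 : ℝ × ℝ → ℂ)
    (hu : HelmholtzEq k u (Opos Ω))
    (huc : ContinuousOn u (Opos Ω ∪ Ltil Ω))
    (hg : ∀ x ∈ Opos Ω, g1 x = pd1 u x ∧ g2 x = pd2 u x)
    (hg1 : ContinuousOn g1 (Opos Ω ∪ Ltil Ω))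
    (hg2 : ContinuousOn g2 (Opos Ω ∪ Ltil Ω))
    (hbc : ∀ x ∈ Ltil Ω, g2 x + Complex.I * lam * u x = 0) (x : ℝ × ℝ) (hx : x ∈ Ω) :
    Hz (k ^ 2) (reflExt lam u) x := by
  have hOo : IsOpen (Opos Ω) := hΩo.inter (isOpen_lt continuous_const continuous_snd)
  set r := |x.2| with hr
  have hr0 : 0 ≤ r := abs_nonneg _
  have top : (x.1, r) ∈ Ω := by
    rcases abs_choice x.2 with h | h
    · rw [hr, h]; exact hx
    · rw [hr, h]; exact (hsym x).1 hx
  have seg0 : ∀ t, 0 ≤ t → t ≤ r → (x.1, t) ∈ Ω := by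
    intro t h0 h1
    rcases eq_or_lt_of_le h1 with h | h
    · rw [h]; exact top
    · have m : (x.1, r) ∈ Opos Ω := ⟨top, lt_of_le_of_lt h0 h⟩
      rcases eq_or_lt_of_le h0 with h' | h'
      · rw [← h']; exact (hcol _ m).1.1
      · exact ((hcol _ m).2 t h' h).1
  have seg : ({x.1} ×ˢ Icc (-r) r : Set (ℝ × ℝ)) ⊆ Ω := by
    rintro ⟨s, t⟩ ⟨hs, ht⟩
    obtain rfl : s = x.1 := hs
    rcases le_total 0 t with h | h
    · exact seg0 t h ht.2
    · have := (hsym _).1 (seg0 (-t) (by linarith) (by linarith [ht.1]))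
      simpa using this
  obtain ⟨δ, hδ, hsub⟩ := (isCompact_singleton.prod (isCompact_Icc (a := -r) (b := r))).exists_cthickening_subset_open hΩo seg
  set α := x.1 - δ with hα
  set β := x.1 + δ with hβ
  set d := r + δ with hd
  have d0 : 0 < d := by linarith
  have rect : ∀ s ∈ Icc α β, ∀ t ∈ Icc 0 d, (s, t) ∈ Ω := by
    intro s hs t ht
    apply hsub
    refine mem_cthickening_of_dist_le (s, t) (x.1, min t r) δ _ ⟨rfl, ?_⟩ ?_
    · exact ⟨by simp only [le_min_iff]; constructor <;> linarith [ht.1], min_le_right _ _⟩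
    · rw [Prod.dist_eq]
      refine max_le ?_ ?_
      · simp only [Real.dist_eq, abs_le]
        constructor <;> linarith [hs.1, hs.2]
      · simp only [Real.dist_eq, abs_le]
        rcases le_total t r with h | h
        · rw [min_eq_left h]; constructor <;> linarith
        · rw [min_eq_right h]; constructor <;> linarith [ht.2]
  have rect' : ∀ s ∈ Icc α β, ∀ t ∈ Icc 0 d, (s, t) ∈ Opos Ω ∪ Ltil Ω := by
    intro s hs t ht
    rcases eq_or_lt_of_le ht.1 with h | h
    · exact Or.inr ⟨rect s hs t ht, h.symm⟩
    · exact Or.inl ⟨rect s hs t ht, h⟩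
  let cl : ℝ × ℝ → ℝ × ℝ := fun p => (max α (min β p.1), max 0 (min d p.2))
  have clc : Continuous cl := by fun_prop
  have clm1 : ∀ s, max α (min β s) ∈ Icc α β := fun s => ⟨le_max_left _ _, max_le (by linarith) (min_le_left _ _)⟩
  have clm2 : ∀ s, max 0 (min d s) ∈ Icc 0 d := fun s => ⟨le_max_left _ _, max_le (by linarith) (min_le_left _ _)⟩
  have clm : ∀ p, cl p ∈ Opos Ω ∪ Ltil Ω := fun p => rect' _ (clm1 _) _ (clm2 _)
  have cleq : ∀ s ∈ Ioo α β, ∀ t, 0 ≤ t → t < d → cl (s, t) = (s, t) := by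
    intro s hs t h0 h1
    simp only [cl]
    rw [min_eq_right hs.2.le, max_eq_right hs.1.le, min_eq_right h1.le, max_eq_right h0]
  have hP : IsOpen (Ioo α β ×ˢ Ioo 0 d) := isOpen_Ioo.prod isOpen_Ioo
  have hQ : IsOpen (Ioo α β ×ˢ Ioo (-d) d) := isOpen_Ioo.prod isOpen_Ioo
  have PO : ∀ p ∈ Ioo α β ×ˢ Ioo 0 d, p ∈ Opos Ω := by
    rintro ⟨s, t⟩ ⟨hs, ht⟩
    exact ⟨rect s (Ioo_subset_Icc_self hs) t (Ioo_subset_Icc_self ht), ht.1⟩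
  have clP : ∀ p ∈ Ioo α β ×ˢ Ioo 0 d, cl p = p := fun p hp => cleq p.1 hp.1 p.2 hp.2.1.le hp.2.2
  have ev : ∀ p ∈ Ioo α β ×ˢ Ioo 0 d, (u ∘ cl) =ᶠ[𝓝 p] u := by
    intro p hp
    filter_upwards [hP.mem_nhds hp] with q hq
    simp [clP q hq]
  have uC : ∀ p ∈ Ioo α β ×ˢ Ioo 0 d, ContDiffAt ℝ 2 u p := fun p hp =>
    hu.1.contDiffAt (hOo.mem_nhds (PO p hp))
  have uD : ∀ p ∈ Ioo α β ×ˢ Ioo 0 d, DifferentiableAt ℝ u p := fun p hp =>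
    (uC p hp).differentiableAt (by norm_num)
  have main := local_rect (Complex.I * lam) (k ^ 2) (U := u ∘ cl) (G1 := g1 ∘ cl) (G2 := g2 ∘ cl)
    (α := α) (β := β) d0 (huc.comp_continuous clc clm) (hg1.comp_continuous clc clm)
    (hg2.comp_continuous clc clm)
    (by
      intro s
      apply hbc
      have : max 0 (min d 0) = 0 := by rw [min_eq_right d0.le, max_self]
      refine ⟨rect _ (clm1 _) _ (clm2 _), this⟩)
    (by
      intro p hp
      refine Hz.congr ⟨uC p hp, ?_⟩ (ev p hp)
      rw [← lapl_eq (uC p hp)]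
      exact hu.2 p (PO p hp))
    (by
      intro p hp
      rw [(ev p hp).fderiv_eq, ← pd1_eq (uD p hp), ← (hg p (PO p hp)).1]
      simp [clP p hp])
    (by
      intro p hp
      rw [(ev p hp).fderiv_eq, ← pd2_eq (uD p hp), ← (hg p (PO p hp)).2]
      simp [clP p hp])
  have xQ : x ∈ Ioo α β ×ˢ Ioo (-d) d := by
    refine ⟨⟨by linarith, by linarith⟩, ?_⟩
    have := abs_le.1 (le_of_eq hr.symm)
    exact ⟨by linarith [this.1], by linarith [this.2]⟩
  refine (main x xQ).congr ?_
  filter_upwards [hQ.mem_nhds xQ] with q hq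
  obtain ⟨s, t⟩ := q
  obtain ⟨hs, ht⟩ := hq
  simp only at hs ht
  unfold reflExt
  by_cases h : 0 ≤ t
  · simp [h, cleq s hs t h ht.2]
  · have h' : t < 0 := not_le.1 h
    simp only [h, if_false, Function.comp, Wint, Jint]
    rw [cleq s hs (-t) (by linarith) (by linarith [ht.1])]
    have : ∫ y in (0:ℝ)..(-t), cexp (-(Complex.I * lam * (y : ℂ))) * u (cl (s, y)) =
        ∫ y in (0:ℝ)..(-t), cexp (-(Complex.I * lam * (y : ℂ))) * u (s, y) := by
      apply intervalIntegral.integral_congr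
      intro y hy
      rw [uIcc_of_le (by linarith)] at hy
      simp only
      rw [cleq s hs y hy.1 (by linarith [hy.2, ht.1])]
    rw [this]
    push_cast
    rw [mul_neg]
    ring

end helpers

/-- **Point-to-point reflection for the Helmholtz equation under the column condition.**
If `Ω` is symmetric w.r.t. `L` and satisfies the column condition, `u` solves
`Δu + k²u = 0` on `Ω⁺`, `u, ∂₁u, ∂₂u` extend continuously to `Ω⁺ ∪ L̃` (extensions
`g1, g2`), and `∂₂u + iλu = 0` on `L̃`, then the explicitly reflected function solves the
Helmholtz equation on all of `Ω`. -/
theorem helmholtz_reflection_column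
    (k lam : ℂ) (Ω : Set (ℝ × ℝ)) (hΩo : IsOpen Ω) (hΩc : IsConnected Ω)
    (hsym : SymmetricWrtL Ω) (hcol : ColumnCond Ω)
    (u g1 g2 : ℝ × ℝ → ℂ)
    (hu : HelmholtzEq k u (Opos Ω))
    (huc : ContinuousOn u (Opos Ω ∪ Ltil Ω))
    (hg : ∀ x ∈ Opos Ω, g1 x = pd1 u x ∧ g2 x = pd2 u x)
    (hg1 : ContinuousOn g1 (Opos Ω ∪ Ltil Ω))
    (hg2 : ContinuousOn g2 (Opos Ω ∪ Ltil Ω))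
    (hbc : ∀ x ∈ Ltil Ω, g2 x + Complex.I * lam * u x = 0) :
    HelmholtzEq k (reflExt lam u) Ω := by
  have key := hz_at k lam Ω hΩo hsym hcol u g1 g2 hu huc hg hg1 hg2 hbc
  refine ⟨fun x hx => (key x hx).1.contDiffWithinAt, fun x hx => ?_⟩
  rw [lapl_eq (key x hx).1]
  exact (key x hx).2
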